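/- Let 0<q<1, v > -1 and 0 < μ < 1. For all x, y, z ∈ ℝ_q^+, the mixed kernel T_{v,v+μ,v}(x,y,z) = c_{q,v+μ}² ∫_0^∞ j_v(tx,q²) j_{v+μ}(ty,q²) j_{v+μ}(tz,q²) t^{2v+1} d_q t satisfies T_{v,v+μ,v}(x,y,z) = Σ_{i,j=0}^∞ ((q^{2μ};q²)_i/(q²;q²)_i) ((q^{2μ};q²)_j/(q²;q²)_j) q^{2(1+v)(i+j)} D_v(x, q^i y, q^j z), the double series converging absolutely; consequently, if q ∈ Q_v then T_{v,v+μ,v}(x,y,z) ≥ 0. -/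

import Mathlib

open scoped BigOperators

noncomputable section

/-- Finite q-Pochhammer symbol `(a;q)_n = ∏_{i=0}^{n-1} (1 - a q^i)`. -/
def qPoch (a q : ℝ) (n : ℕ) : ℝ := ∏ i ∈ Finset.range n, (1 - a * q ^ i)

/-- Infinite q-Pochhammer symbol `(a;q)_∞ = ∏_{i=0}^{∞} (1 - a q^i)`. -/
def qPochInf (a q : ℝ) : ℝ := ∏' i : ℕ, (1 - a * q ^ i)

/-- Normalized Hahn–Exton q-Bessel function `j_v(x,q²)`. -/
def jHE (q v x : ℝ) : ℝ :=
  ∑' n : ℕ, (-1 : ℝ) ^ n * q ^ (n * (n + 1)) * x ^ (2 * n) /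
    (qPoch (q ^ 2) (q ^ 2) n * qPoch (q ^ (2 * v + 2)) (q ^ 2) n)

/-- Hahn–Exton q-Bessel function with base `p`:
`J_v(x,p) = (x^v/(p;p)_∞) Σ_{n} (-1)^n p^{n(n+1)/2} (p^{v+n+1};p)_∞ x^{2n}/(p;p)_n`.
With `p = q²` this is `J_v(x,q²)`. -/
def JHE (p v x : ℝ) : ℝ :=
  (x ^ v / qPochInf p p) *
    ∑' n : ℕ, (-1 : ℝ) ^ n * p ^ (((n : ℝ) * ((n : ℝ) + 1)) / 2) *
      qPochInf (p ^ (v + (n : ℝ) + 1)) p * x ^ (2 * n) / qPoch p p n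

/-- The constant `c_{q,v}`. -/
def cqv (q v : ℝ) : ℝ :=
  (1 / (1 - q)) * qPochInf (q ^ (2 * v + 2)) (q ^ 2) / qPochInf (q ^ 2) (q ^ 2)

/-- Jackson q-integral on `[0,∞)`: `∫_0^∞ f(x) d_q x = (1-q) Σ_{n∈ℤ} q^n f(q^n)`. -/
def jackson (q : ℝ) (f : ℝ → ℝ) : ℝ := (1 - q) * ∑' n : ℤ, q ^ n * f (q ^ n)

/-- The q-lattice `ℝ_q^+ = {q^n : n ∈ ℤ}`. -/
def Rq (q : ℝ) : Set ℝ := {x | ∃ n : ℤ, x = q ^ n}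

/-- Membership in `L_{q,1,v}`: the Jackson integral `∫_0^∞ |f(x)| x^{2v+1} d_q x`
converges (absolutely). -/
def memL1 (q v : ℝ) (f : ℝ → ℝ) : Prop :=
  Summable fun n : ℤ => q ^ n * |f (q ^ n)| * (q ^ n) ^ (2 * v + 1 : ℝ)

/-- q-Bessel Fourier transform `F_{q,v}`. -/
def qFourier (q v : ℝ) (f : ℝ → ℝ) (x : ℝ) : ℝ :=
  cqv q v * jackson q fun t => f t * jHE q v (x * t) * t ^ (2 * v + 1 : ℝ)

/-- q-translation operator `T_{q,x}^v`. -/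
def qTrans (q v x : ℝ) (f : ℝ → ℝ) (y : ℝ) : ℝ :=
  cqv q v * jackson q fun t =>
    qFourier q v f t * jHE q v (x * t) * jHE q v (y * t) * t ^ (2 * v + 1 : ℝ)

/-- The kernel `D_v(x,y,z)`. -/
def Dker (q v x y z : ℝ) : ℝ :=
  (cqv q v) ^ 2 * jackson q fun t =>
    jHE q v (x * t) * jHE q v (y * t) * jHE q v (z * t) * t ^ (2 * v + 1 : ℝ)

/-- Positivity of the q-translation operator `T_{q,x}^v`. -/
def IsPosT (q v x : ℝ) : Prop :=
  ∀ f : ℝ → ℝ, memL1 q v f → (∀ y ∈ Rq q, 0 ≤ f y) → ∀ y ∈ Rq q, 0 ≤ qTrans q v x f y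

/-- The positivity domain `Q_v`. -/
def Qset (v : ℝ) : Set ℝ :=
  {q | q ∈ Set.Ioo (0 : ℝ) 1 ∧ ∀ x ∈ Rq q, IsPosT q v x}

/-- The kernel `E_{v,x}(q^m,q^z,q^k)`. -/
def Ekern (q v x : ℝ) (m z k : ℤ) : ℝ :=
  (1 / ((1 - q) ^ 2 * cqv q v * cqv q (x - v))) *
    q ^ (-(k : ℝ) * (x + 2) - (m : ℝ) * v - (z : ℝ) * (x - v)) *
    JHE (q ^ 2) ((z : ℝ) - (k : ℝ)) (q ^ (x - v + (m : ℝ) - (k : ℝ))) *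
    JHE (q ^ 2) (v + (z : ℝ) - (k : ℝ)) (q ^ ((m : ℝ) - (k : ℝ)))

/-- The function `q ↦ ₁φ₁(0;q;q,q) = Σ_{n} (-1)^n q^{n(n+1)/2} q^n /((q;q)_n)²`. -/
def phiQ (q : ℝ) : ℝ :=
  ∑' n : ℕ, (-1 : ℝ) ^ n * q ^ (((n : ℝ) * ((n : ℝ) + 1)) / 2) * q ^ n / (qPoch q q n) ^ 2

/-- The mixed kernel `T_{v,w,α}(x,y,z)`. -/
def Tmix (q v w a x y z : ℝ) : ℝ :=
  (cqv q w) ^ 2 * jackson q (fun t =>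
    jHE q v (t * x) * jHE q w (t * y) * jHE q w (t * z) * t ^ (2 * a + 1 : ℝ))

open Filter Topology

section QSeries

variable {p : ℝ}

lemma summable_const_mul_geometric (hp0 : 0 < p) (hp1 : p < 1) (a : ℝ) :
    Summable fun i : ℕ => a * p ^ i :=
  (summable_geometric_of_lt_one hp0.le hp1).mul_left a

lemma multipliable_qPochInf (hp0 : 0 < p) (hp1 : p < 1) (a : ℝ) :
    Multipliable fun i : ℕ => 1 - a * p ^ i := by
  simpa [sub_eq_add_neg] using
    Real.multipliable_one_add_of_summable (summable_const_mul_geometric hp0 hp1 a).neg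

lemma tendsto_qPoch (hp0 : 0 < p) (hp1 : p < 1) (a : ℝ) :
    Tendsto (qPoch a p) atTop (𝓝 (qPochInf a p)) :=
  (multipliable_qPochInf hp0 hp1 a).tendsto_prod_tprod_nat

lemma qPoch_succ (a p : ℝ) (n : ℕ) : qPoch a p (n + 1) = qPoch a p n * (1 - a * p ^ n) :=
  Finset.prod_range_succ _ _

lemma qPoch_mul_qPochInf (hp0 : 0 < p) (hp1 : p < 1) (a : ℝ) (n : ℕ) :
    qPoch a p n * qPochInf (a * p ^ n) p = qPochInf a p := by
  have h := Multipliable.prod_mul_tprod_nat_mul' (f := fun i : ℕ => 1 - a * p ^ i) (k := n)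
    (by simpa [pow_add, mul_comm, mul_left_comm, mul_assoc]
          using multipliable_qPochInf hp0 hp1 (a * p ^ n))
  simpa [qPoch, qPochInf, pow_add, mul_comm, mul_left_comm, mul_assoc] using h

lemma mul_pow_lt_one (hp0 : 0 < p) (hp1 : p < 1) {a : ℝ} (ha0 : 0 ≤ a) (ha1 : a < 1) (n : ℕ) :
    a * p ^ n < 1 :=
  (mul_le_of_le_one_right ha0 (pow_le_one₀ hp0.le hp1.le)).trans_lt ha1

lemma qPoch_pos (hp0 : 0 < p) (hp1 : p < 1) {a : ℝ} (ha0 : 0 ≤ a) (ha1 : a < 1) (n : ℕ) :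
    0 < qPoch a p n :=
  Finset.prod_pos fun i _ => sub_pos.2 (mul_pow_lt_one hp0 hp1 ha0 ha1 i)

lemma antitone_qPoch (hp0 : 0 < p) (hp1 : p < 1) {a : ℝ} (ha0 : 0 ≤ a) (ha1 : a < 1) :
    Antitone (qPoch a p) := by
  refine antitone_nat_of_succ_le fun n => ?_
  rw [qPoch_succ]
  refine mul_le_of_le_one_right (qPoch_pos hp0 hp1 ha0 ha1 n).le ?_
  have : 0 ≤ a * p ^ n := by positivity
  linarith

lemma qPochInf_le_qPoch (hp0 : 0 < p) (hp1 : p < 1) {a : ℝ} (ha0 : 0 ≤ a) (ha1 : a < 1) (n : ℕ) :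
    qPochInf a p ≤ qPoch a p n :=
  (antitone_qPoch hp0 hp1 ha0 ha1).le_of_tendsto (tendsto_qPoch hp0 hp1 a) n

lemma qPochInf_nonneg (hp0 : 0 < p) (hp1 : p < 1) {a : ℝ} (ha0 : 0 ≤ a) (ha1 : a < 1) :
    0 ≤ qPochInf a p :=
  ge_of_tendsto' (tendsto_qPoch hp0 hp1 a) fun n => (qPoch_pos hp0 hp1 ha0 ha1 n).le

lemma qPochInf_le_one (hp0 : 0 < p) (hp1 : p < 1) {a : ℝ} (ha0 : 0 ≤ a) (ha1 : a < 1) :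
    qPochInf a p ≤ 1 := by
  simpa [qPoch] using qPochInf_le_qPoch hp0 hp1 ha0 ha1 0

/-- Series whose coefficients satisfy a first order `q`-recurrence converge absolutely. -/
lemma summable_of_qrec (hp0 : 0 < p) (hp1 : p < 1) {A : ℕ → ℝ} {α β z : ℝ}
    (hA : ∀ k, A (k + 1) * (1 - p ^ (k + 1)) = A k * (α - β * p ^ k)) (hz : |α * z| < 1) :
    Summable fun k => |A k * z ^ k| := by
  obtain ⟨r, hr, hr1⟩ := exists_between hz
  have hpk : Tendsto (fun k : ℕ => p ^ k) atTop (𝓝 0) :=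
    tendsto_pow_atTop_nhds_zero_of_lt_one hp0.le hp1
  have hlim : Tendsto (fun k : ℕ => |(α - β * p ^ k) / (1 - p ^ (k + 1)) * z|) atTop
      (𝓝 |α * z|) := by
    have h := (((tendsto_const_nhds (x := α)).sub (hpk.const_mul β)).div
      ((tendsto_const_nhds (x := (1 : ℝ))).sub ((tendsto_add_atTop_iff_nat 1).2 hpk))
      (by simp)).mul_const z |>.abs
    simpa using h
  refine summable_of_ratio_norm_eventually_le hr1 ?_
  filter_upwards [hlim.eventually_le_const hr] with k hk
  have hne : 1 - p ^ (k + 1) ≠ 0 := (sub_pos.2 (pow_lt_one₀ hp0.le hp1 k.succ_ne_zero)).ne'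
  have hA' : A (k + 1) * z ^ (k + 1) =
      ((α - β * p ^ k) / (1 - p ^ (k + 1)) * z) * (A k * z ^ k) := by
    rw [eq_div_of_mul_eq hne (hA k)]
    ring
  rw [hA', norm_abs_eq_norm, norm_abs_eq_norm, norm_mul]
  exact mul_le_mul_of_nonneg_right hk (norm_nonneg _)

/-- Common form of Euler's identity and of the `q`-binomial theorem. -/
lemma qPochInf_mul_tsum_of_qrec (hp0 : 0 < p) (hp1 : p < 1) {A : ℕ → ℝ} {α β z : ℝ}
    (hA : ∀ k, A (k + 1) * (1 - p ^ (k + 1)) = A k * (α - β * p ^ k)) (hz : |α * z| < 1) :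
    qPochInf (α * z) p * ∑' k, A k * z ^ k = qPochInf (β * z) p * A 0 := by
  set F : ℝ → ℝ := fun x => ∑' k, A k * x ^ k with hF
  have hsm : ∀ n : ℕ, Summable fun k => |A k * (z * p ^ n) ^ k| := fun n => by
    refine summable_of_qrec hp0 hp1 hA ?_
    rw [← mul_assoc, abs_mul, abs_of_pos (pow_pos hp0 n)]
    exact mul_pow_lt_one hp0 hp1 (abs_nonneg _) hz n
  have hstep : ∀ n : ℕ, (1 - α * z * p ^ n) * F (z * p ^ n) =
      (1 - β * z * p ^ n) * F (z * p ^ (n + 1)) := fun n => by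
    set x := z * p ^ n with hx
    have hx' : z * p ^ (n + 1) = p * x := by rw [hx]; ring
    have hs : Summable fun k => A k * x ^ k := (hsm n).of_abs
    have hs' : Summable fun k => A k * (p * x) ^ k := by
      rw [← hx']; exact (hsm (n + 1)).of_abs
    have h1 : F x - F (p * x) = ∑' k, A k * (1 - p ^ k) * x ^ k := by
      rw [hF, ← hs.tsum_sub hs']
      exact tsum_congr fun k => by rw [mul_pow]; ring
    have hs'' : Summable fun k => A k * (1 - p ^ k) * x ^ k := by
      refine (hs.sub hs').congr fun k => ?_
      rw [mul_pow]; ring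
    have h2 : ∑' k, A k * (1 - p ^ k) * x ^ k = α * x * F x - β * x * F (p * x) := by
      rw [hs''.tsum_eq_zero_add, hF, ← tsum_mul_left, ← tsum_mul_left,
        ← (hs.mul_left _).tsum_sub (hs'.mul_left _)]
      simp only [pow_zero, sub_self, mul_zero, zero_mul, zero_add]
      exact tsum_congr fun k => by rw [hA, mul_pow]; ring
    rw [hx']
    have e1 : α * z * p ^ n = α * x := by rw [hx]; ring
    have e2 : β * z * p ^ n = β * x := by rw [hx]; ring
    rw [e1, e2]
    linarith
  have hiter : ∀ n : ℕ, qPoch (α * z) p n * F z = qPoch (β * z) p n * F (z * p ^ n) := by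
    intro n
    induction n with
    | zero => simp [qPoch]
    | succ n ih =>
      rw [qPoch_succ, qPoch_succ]
      linear_combination (1 - α * z * p ^ n) * ih + qPoch (β * z) p n * hstep n
  have hpk : Tendsto (fun k : ℕ => p ^ k) atTop (𝓝 0) :=
    tendsto_pow_atTop_nhds_zero_of_lt_one hp0.le hp1
  have hF0 : Tendsto (fun n : ℕ => F (z * p ^ n)) atTop (𝓝 (A 0)) := by
    have hA0 : A 0 = ∑' k, A k * (0 : ℝ) ^ k := by
      rw [tsum_eq_single 0 (fun k hk => by simp [hk])]; simp
    rw [hA0]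
    refine tendsto_tsum_of_dominated_convergence (bound := fun k => |A k * z ^ k|)
      (by simpa using hsm 0) (fun k => ?_) (Eventually.of_forall fun n k => ?_)
    · have := ((hpk.const_mul z).pow k).const_mul (A k)
      simpa using this
    · rw [mul_pow, ← mul_assoc, norm_mul, Real.norm_eq_abs, Real.norm_eq_abs]
      refine mul_le_of_le_one_right (abs_nonneg _) ?_
      rw [abs_of_nonneg (by positivity)]
      exact pow_le_one₀ (by positivity) (pow_le_one₀ hp0.le hp1.le)
  refine tendsto_nhds_unique ((tendsto_qPoch hp0 hp1 _).mul_const (F z)) ?_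
  simp_rw [hiter]
  exact (tendsto_qPoch hp0 hp1 _).mul hF0

lemma qPochInf_pos (hp0 : 0 < p) (hp1 : p < 1) {a : ℝ} (ha0 : 0 ≤ a) (ha1 : a < 1) :
    0 < qPochInf a p := by
  have h := qPochInf_mul_tsum_of_qrec hp0 hp1 (A := fun k => 1 / qPoch p p k)
    (α := 1) (β := 0) (z := a) (fun k => by
      have h1 := (qPoch_pos hp0 hp1 hp0.le hp1 k).ne'
      have h2 : 1 - p ^ (k + 1) ≠ 0 := (sub_pos.2 (pow_lt_one₀ hp0.le hp1 k.succ_ne_zero)).ne'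
      rw [qPoch_succ, ← pow_succ']
      field_simp
      ring) (by rwa [one_mul, abs_of_nonneg ha0])
  refine lt_of_le_of_ne (qPochInf_nonneg hp0 hp1 ha0 ha1) fun h0 => ?_
  rw [one_mul, ← h0, zero_mul, zero_mul] at h
  simp [qPochInf, qPoch] at h

/-- The coefficients of Euler's expansion of `(x;p)_∞`. -/
def eulerCoeff (p : ℝ) (k : ℕ) : ℝ := (-1) ^ k * p ^ k.choose 2 / qPoch p p k

lemma eulerCoeff_rec (hp0 : 0 < p) (hp1 : p < 1) (k : ℕ) :
    eulerCoeff p (k + 1) * (1 - p ^ (k + 1)) = eulerCoeff p k * (0 - 1 * p ^ k) := by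
  have h1 := (qPoch_pos hp0 hp1 hp0.le hp1 k).ne'
  have h2 : 1 - p ^ (k + 1) ≠ 0 := (sub_pos.2 (pow_lt_one₀ hp0.le hp1 k.succ_ne_zero)).ne'
  rw [eulerCoeff, eulerCoeff, qPoch_succ, ← pow_succ', Nat.choose_succ_succ' k 1,
    Nat.choose_one_right]
  field_simp
  ring

lemma summable_eulerCoeff (hp0 : 0 < p) (hp1 : p < 1) (z : ℝ) :
    Summable fun k => |eulerCoeff p k * z ^ k| :=
  summable_of_qrec hp0 hp1 (eulerCoeff_rec hp0 hp1) (by simp)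

lemma tsum_eulerCoeff (hp0 : 0 < p) (hp1 : p < 1) (z : ℝ) :
    ∑' k, eulerCoeff p k * z ^ k = qPochInf z p := by
  simpa [qPochInf, eulerCoeff, qPoch] using
    qPochInf_mul_tsum_of_qrec hp0 hp1 (eulerCoeff_rec hp0 hp1) (z := z) (by simp)

lemma qBinomial_rec (hp0 : 0 < p) (hp1 : p < 1) (a : ℝ) (k : ℕ) :
    qPoch a p (k + 1) / qPoch p p (k + 1) * (1 - p ^ (k + 1)) =
      qPoch a p k / qPoch p p k * (1 - a * p ^ k) := by
  have h1 := (qPoch_pos hp0 hp1 hp0.le hp1 k).ne'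
  have h2 : 1 - p ^ (k + 1) ≠ 0 := (sub_pos.2 (pow_lt_one₀ hp0.le hp1 k.succ_ne_zero)).ne'
  rw [qPoch_succ, qPoch_succ, ← pow_succ']
  field_simp

lemma summable_qBinomial (hp0 : 0 < p) (hp1 : p < 1) (a : ℝ) {z : ℝ} (hz : |z| < 1) :
    Summable fun k => |qPoch a p k / qPoch p p k * z ^ k| :=
  summable_of_qrec hp0 hp1 (qBinomial_rec hp0 hp1 a) (by simpa using hz)

/-- The `q`-binomial theorem. -/
lemma qPochInf_mul_tsum_qBinomial (hp0 : 0 < p) (hp1 : p < 1) (a : ℝ) {z : ℝ} (hz : |z| < 1) :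
    qPochInf z p * ∑' k, qPoch a p k / qPoch p p k * z ^ k = qPochInf (a * z) p := by
  simpa [qPoch] using
    qPochInf_mul_tsum_of_qrec hp0 hp1 (A := fun k => qPoch a p k / qPoch p p k) (α := 1)
      (qBinomial_rec hp0 hp1 a) (z := z) (by rwa [one_mul])

/-- The series `₁φ₁(0;c;p,z)`. -/
def phiOne (p c z : ℝ) : ℝ := ∑' n, eulerCoeff p n * z ^ n / qPoch c p n

lemma summable_phiOne (hp0 : 0 < p) (hp1 : p < 1) {c : ℝ} (hc0 : 0 ≤ c) (hc1 : c < 1) (z : ℝ) :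
    Summable fun n => |eulerCoeff p n * z ^ n / qPoch c p n| := by
  refine Summable.of_nonneg_of_le (fun _ => abs_nonneg _) (fun n => ?_)
    ((summable_eulerCoeff hp0 hp1 z).div_const (qPochInf c p))
  rw [abs_div, abs_of_pos (qPoch_pos hp0 hp1 hc0 hc1 n)]
  exact div_le_div_of_nonneg_left (abs_nonneg _) (qPochInf_pos hp0 hp1 hc0 hc1)
    (qPochInf_le_qPoch hp0 hp1 hc0 hc1 n)

lemma summable_prod_of_factors {ι κ : Type*} {f : ι → ℝ} {g : κ → ℝ} {h : ι → κ → ℝ}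
    (hf : Summable fun i => |f i|) (hg : Summable fun k => |g k|) {C : ℝ}
    (hh : ∀ i k, |h i k| ≤ C) :
    Summable fun x : ι × κ => |f x.1 * g x.2 * h x.1 x.2| := by
  refine Summable.of_nonneg_of_le (fun _ => abs_nonneg _) (fun x => ?_)
    ((Summable.mul_of_nonneg hf hg (fun _ => abs_nonneg _) (fun _ => abs_nonneg _)).mul_right C)
  rw [abs_mul, abs_mul]
  exact mul_le_mul_of_nonneg_left (hh _ _) (by positivity)

/-- The symmetry `(c;p)_∞ ₁φ₁(0;c;p,z) = (z;p)_∞ ₁φ₁(0;z;p,c)`, in a form valid for all `z`. -/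
lemma qPochInf_mul_phiOne (hp0 : 0 < p) (hp1 : p < 1) {c : ℝ} (hc0 : 0 ≤ c) (hc1 : c < 1)
    (z : ℝ) :
    qPochInf c p * phiOne p c z = ∑' k, eulerCoeff p k * c ^ k * qPochInf (z * p ^ k) p := by
  have hs := summable_prod_of_factors (summable_eulerCoeff hp0 hp1 z)
    (summable_eulerCoeff hp0 hp1 c) (h := fun n k => p ^ (n * k)) (C := 1)
    fun n k => by rw [abs_of_pos (by positivity)]; exact pow_le_one₀ hp0.le hp1.le
  have hcomm := Summable.tsum_comm
    (f := fun n k => eulerCoeff p n * z ^ n * (eulerCoeff p k * c ^ k) * p ^ (n * k)) hs.of_abs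
  rw [phiOne, ← tsum_mul_left]
  calc ∑' n, qPochInf c p * (eulerCoeff p n * z ^ n / qPoch c p n)
      = ∑' n, ∑' k, eulerCoeff p n * z ^ n * (eulerCoeff p k * c ^ k) * p ^ (n * k) := by
        refine tsum_congr fun n => ?_
        have h1 := (qPoch_pos hp0 hp1 hc0 hc1 n).ne'
        rw [← qPoch_mul_qPochInf hp0 hp1 c n, ← tsum_eulerCoeff hp0 hp1 (c * p ^ n),
          mul_comm, ← mul_assoc, div_mul_cancel₀ _ h1, ← tsum_mul_left]
        exact tsum_congr fun k => by rw [mul_pow, ← pow_mul]; ring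
    _ = ∑' k, ∑' n, eulerCoeff p n * z ^ n * (eulerCoeff p k * c ^ k) * p ^ (n * k) := hcomm.symm
    _ = _ := by
        refine tsum_congr fun k => ?_
        rw [← tsum_eulerCoeff hp0 hp1 (z * p ^ k), ← tsum_mul_left]
        exact tsum_congr fun n => by rw [mul_pow, ← pow_mul, mul_comm k n]; ring

/-- Raising the parameter of `₁φ₁`. -/
lemma qPochInf_mul_phiOne_mul (hp0 : 0 < p) (hp1 : p < 1) {a c : ℝ} (ha0 : 0 ≤ a) (ha1 : a < 1)
    (hc0 : 0 ≤ c) (hc1 : c < 1) (z : ℝ) :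
    qPochInf (a * c) p * phiOne p (a * c) z =
      qPochInf c p * ∑' i, qPoch a p i / qPoch p p i * c ^ i * phiOne p c (p ^ i * z) := by
  have hac0 : 0 ≤ a * c := mul_nonneg ha0 hc0
  have hac1 : a * c < 1 := mul_lt_one_of_nonneg_of_lt_one_left ha0 ha1 hc1.le
  have hs := summable_prod_of_factors (summable_phiOne hp0 hp1 hc0 hc1 z)
    (summable_qBinomial hp0 hp1 a (z := c) (by rwa [abs_of_nonneg hc0]))
    (h := fun n k => p ^ (n * k)) (C := 1)
    fun n k => by rw [abs_of_pos (by positivity)]; exact pow_le_one₀ hp0.le hp1.le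
  have hcomm := Summable.tsum_comm
    (f := fun n k => eulerCoeff p n * z ^ n / qPoch c p n *
      (qPoch a p k / qPoch p p k * c ^ k) * p ^ (n * k)) hs.of_abs
  calc qPochInf (a * c) p * phiOne p (a * c) z
      = qPochInf c p * ∑' n, ∑' k, eulerCoeff p n * z ^ n / qPoch c p n *
          (qPoch a p k / qPoch p p k * c ^ k) * p ^ (n * k) := by
        rw [phiOne, ← tsum_mul_left, ← tsum_mul_left]
        refine tsum_congr fun n => ?_
        have h1 := (qPoch_pos hp0 hp1 hc0 hc1 n).ne'
        have h2 := (qPoch_pos hp0 hp1 hac0 hac1 n).ne'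
        have hcn : |c * p ^ n| < 1 := by
          rw [abs_of_nonneg (by positivity)]
          exact mul_pow_lt_one hp0 hp1 hc0 hc1 n
        have h3 : ∑' k, eulerCoeff p n * z ^ n / qPoch c p n *
            (qPoch a p k / qPoch p p k * c ^ k) * p ^ (n * k) =
            eulerCoeff p n * z ^ n / qPoch c p n *
              ∑' k, qPoch a p k / qPoch p p k * (c * p ^ n) ^ k := by
          rw [← tsum_mul_left]
          exact tsum_congr fun k => by rw [mul_pow, ← pow_mul]; ring
        rw [h3, ← qPoch_mul_qPochInf hp0 hp1 (a * c) n, mul_assoc a c,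
          ← qPochInf_mul_tsum_qBinomial hp0 hp1 a hcn, ← qPoch_mul_qPochInf hp0 hp1 c n]
        field_simp
    _ = qPochInf c p * ∑' k, ∑' n, eulerCoeff p n * z ^ n / qPoch c p n *
          (qPoch a p k / qPoch p p k * c ^ k) * p ^ (n * k) := by rw [hcomm]
    _ = _ := by
        congr 1
        refine tsum_congr fun k => ?_
        rw [phiOne, ← tsum_mul_left]
        exact tsum_congr fun n => by rw [mul_pow, ← pow_mul, mul_comm k n]; ring

/-- Uniform estimate of `₁φ₁(0;c;p,z)` on the lattice of integral powers of `p`. -/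
lemma exists_abs_phiOne_le (hp0 : 0 < p) (hp1 : p < 1) {c s : ℝ} (hc0 : 0 ≤ c) (hc1 : c < 1)
    (hs0 : 0 < s) (hs1 : s ≤ 1) :
    ∃ K, 0 ≤ K ∧ ∀ n : ℤ, |phiOne p c (p * p ^ n)| ≤ K * s ^ (-n) := by
  have hsum := summable_eulerCoeff hp0 hp1 (c / s)
  have hcp := qPochInf_pos hp0 hp1 hc0 hc1
  refine ⟨(∑' k, |eulerCoeff p k * (c / s) ^ k|) / qPochInf c p,
    div_nonneg (tsum_nonneg fun _ => abs_nonneg _) hcp.le, fun n => ?_⟩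
  rw [div_mul_eq_mul_div, le_div_iff₀ hcp, ← abs_of_pos hcp, ← abs_mul, mul_comm,
    qPochInf_mul_phiOne hp0 hp1 hc0 hc1, ← tsum_mul_right]
  have hterm : ∀ k : ℕ, ‖eulerCoeff p k * c ^ k * qPochInf (p * p ^ n * p ^ k) p‖ ≤
      |eulerCoeff p k * (c / s) ^ k| * s ^ (-n) := by
    intro k
    have hexp : p * p ^ n * p ^ k = p ^ (n + k + 1) := by
      rw [zpow_add_one₀ hp0.ne', zpow_add₀ hp0.ne', zpow_natCast]; ring
    rw [hexp, norm_mul, Real.norm_eq_abs, Real.norm_eq_abs]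
    rcases lt_or_ge (n + k) 0 with hk | hk
    · have hz : qPochInf (p ^ (n + k + 1)) p = 0 := by
        refine tprod_of_exists_eq_zero ⟨(-(n + k + 1)).toNat, ?_⟩
        have h1 : ((-(n + k + 1)).toNat : ℤ) = -(n + k + 1) := Int.toNat_of_nonneg (by omega)
        rw [← zpow_natCast, h1, ← zpow_add₀ hp0.ne', add_neg_cancel, zpow_zero, sub_self]
      rw [hz, abs_zero, mul_zero]
      positivity
    · have hlt : p ^ (n + k + 1) < 1 := zpow_lt_one₀ hp0 hp1 (by omega)
      have hnn : 0 ≤ p ^ (n + k + 1) := by positivity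
      have h1 : |qPochInf (p ^ (n + k + 1)) p| ≤ 1 := by
        rw [abs_of_nonneg (qPochInf_nonneg hp0 hp1 hnn hlt)]
        exact qPochInf_le_one hp0 hp1 hnn hlt
      have h2 : s ^ k ≤ s ^ (-n) := by
        rw [← zpow_natCast]
        exact zpow_le_zpow_right_of_le_one₀ hs0 hs1 (by omega)
      have h3 : eulerCoeff p k * c ^ k = eulerCoeff p k * (c / s) ^ k * s ^ k := by
        rw [div_pow]; field_simp
      rw [h3, abs_mul _ (s ^ k), abs_of_pos (pow_pos hs0 k)]
      calc _ ≤ |eulerCoeff p k * (c / s) ^ k| * s ^ k * 1 :=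
            mul_le_mul_of_nonneg_left h1 (by positivity)
        _ ≤ _ := by
            rw [mul_one]
            exact mul_le_mul_of_nonneg_left h2 (abs_nonneg _)
  exact tsum_of_norm_bounded (hsum.mul_right _).hasSum hterm

end QSeries

section HahnExton

variable {q v : ℝ}

lemma mul_succ_eq_choose (n : ℕ) : n * (n + 1) = 2 * n.choose 2 + 2 * n := by
  induction n with
  | zero => rfl
  | succ n ih =>
    rw [Nat.choose_succ_succ' n 1, Nat.choose_one_right]
    linarith

lemma jHE_eq_phiOne (q v x : ℝ) :
    jHE q v x = phiOne (q ^ 2) (q ^ (2 * v + 2)) (q ^ 2 * x ^ 2) := by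
  refine tsum_congr fun n => ?_
  rw [eulerCoeff, mul_succ_eq_choose, pow_add, mul_pow, ← pow_mul, ← pow_mul, ← pow_mul]
  field_simp

lemma rpow_two_mul_add_two_lt_one (hq0 : 0 < q) (hq1 : q < 1) (hv : -1 < v) :
    q ^ (2 * v + 2) < 1 :=
  Real.rpow_lt_one hq0.le hq1 (by linarith)

lemma exists_abs_jHE_le (hq0 : 0 < q) (hq1 : q < 1) (hv : -1 < v) {s : ℝ} (hs0 : 0 < s)
    (hs1 : s ≤ 1) : ∃ K, 0 ≤ K ∧ ∀ n : ℤ, |jHE q v (q ^ n)| ≤ K * s ^ (-n) := by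
  obtain ⟨K, hK, h⟩ := exists_abs_phiOne_le (p := q ^ 2) (by positivity)
    (pow_lt_one₀ hq0.le hq1 two_ne_zero) (Real.rpow_nonneg hq0.le (2 * v + 2))
    (rpow_two_mul_add_two_lt_one hq0 hq1 hv) hs0 hs1
  refine ⟨K, hK, fun n => ?_⟩
  have hn : (q ^ n) ^ 2 = (q ^ 2) ^ n := by
    rw [← zpow_natCast, ← zpow_natCast, ← zpow_mul, ← zpow_mul, mul_comm]
  rw [jHE_eq_phiOne, hn]
  exact h n

lemma exists_abs_jHE_le_const (hq0 : 0 < q) (hq1 : q < 1) (hv : -1 < v) :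
    ∃ K, 0 ≤ K ∧ ∀ n : ℤ, |jHE q v (q ^ n)| ≤ K := by
  simpa using exists_abs_jHE_le hq0 hq1 hv one_pos le_rfl

lemma summable_zpow_mul_jHE (hq0 : 0 < q) (hq1 : q < 1) (hv : -1 < v) (a : ℤ) :
    Summable fun n : ℤ => |(q ^ (2 * v + 2)) ^ n * jHE q v (q ^ (a + n))| := by
  set c := q ^ (2 * v + 2) with hc
  have hc0 : 0 < c := Real.rpow_pos_of_pos hq0 _
  have hc1 : c < 1 := rpow_two_mul_add_two_lt_one hq0 hq1 hv
  obtain ⟨K, hK, h⟩ := exists_abs_jHE_le_const hq0 hq1 hv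
  obtain ⟨L, hL, h'⟩ := exists_abs_jHE_le hq0 hq1 hv (s := c ^ 2) (by positivity)
    (pow_le_one₀ hc0.le hc1.le)
  have hgeo := summable_geometric_of_lt_one hc0.le hc1
  refine Summable.of_nat_of_neg ?_ ?_
  · refine Summable.of_nonneg_of_le (fun _ => abs_nonneg _) (fun n => ?_) (hgeo.mul_right K)
    rw [abs_mul, abs_of_pos (zpow_pos hc0 _), zpow_natCast]
    exact mul_le_mul_of_nonneg_left (h _) (by positivity)
  · refine Summable.of_nonneg_of_le (fun _ => abs_nonneg _) (fun n => ?_)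
      (hgeo.mul_right (L * c ^ (-(2 * a))))
    rw [abs_mul, abs_of_pos (zpow_pos hc0 _)]
    refine (mul_le_mul_of_nonneg_left (h' _) (by positivity)).trans_eq ?_
    have e : (c ^ 2) ^ (-(a + -(n : ℤ))) = c ^ (-(2 * a)) * c ^ (n : ℤ) * c ^ (n : ℤ) := by
      rw [← zpow_natCast, ← zpow_mul, ← zpow_add₀ hc0.ne', ← zpow_add₀ hc0.ne']
      congr 1
      push_cast
      ring
    rw [e, zpow_neg, zpow_natCast]
    field_simp

/-- Coefficients of the expansion of `j_{v+μ}` in dilates of `j_v`. -/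
def raiseCoeff (q v mu : ℝ) (i : ℕ) : ℝ :=
  qPoch (q ^ (2 * mu)) (q ^ 2) i / qPoch (q ^ 2) (q ^ 2) i * (q ^ (2 * v + 2)) ^ i

lemma summable_raiseCoeff (hq0 : 0 < q) (hq1 : q < 1) (hv : -1 < v) (mu : ℝ) :
    Summable fun i => |raiseCoeff q v mu i| := by
  refine summable_qBinomial (p := q ^ 2) (by positivity) (pow_lt_one₀ hq0.le hq1 two_ne_zero) _ ?_
  rw [abs_of_nonneg (Real.rpow_nonneg hq0.le _)]
  exact rpow_two_mul_add_two_lt_one hq0 hq1 hv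

lemma qBinomialCoeff_nonneg (hq0 : 0 < q) (hq1 : q < 1) {mu : ℝ} (hmu : 0 < mu) (i : ℕ) :
    0 ≤ qPoch (q ^ (2 * mu)) (q ^ 2) i / qPoch (q ^ 2) (q ^ 2) i := by
  have hp0 : 0 < q ^ 2 := by positivity
  have hp1 : q ^ 2 < 1 := pow_lt_one₀ hq0.le hq1 two_ne_zero
  exact div_nonneg (qPoch_pos hp0 hp1 (Real.rpow_nonneg hq0.le (2 * mu))
    (Real.rpow_lt_one hq0.le hq1 (by linarith)) i).le (qPoch_pos hp0 hp1 hp0.le hp1 i).le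

lemma cqv_mul_jHE_add (hq0 : 0 < q) (hq1 : q < 1) (hv : -1 < v) {mu : ℝ} (hmu : 0 < mu) (x : ℝ) :
    cqv q (v + mu) * jHE q (v + mu) x =
      cqv q v * ∑' i, raiseCoeff q v mu i * jHE q v (q ^ i * x) := by
  have h := qPochInf_mul_phiOne_mul (p := q ^ 2) (by positivity)
    (pow_lt_one₀ hq0.le hq1 two_ne_zero)
    (Real.rpow_nonneg hq0.le (2 * mu)) (Real.rpow_lt_one hq0.le hq1 (by linarith : 0 < 2 * mu))
    (Real.rpow_nonneg hq0.le (2 * v + 2)) (rpow_two_mul_add_two_lt_one hq0 hq1 hv) (q ^ 2 * x ^ 2)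
  have e : q ^ (2 * (v + mu) + 2) = q ^ (2 * mu) * q ^ (2 * v + 2) := by
    rw [← Real.rpow_add hq0]; ring_nf
  have hterm : ∀ i : ℕ, raiseCoeff q v mu i * jHE q v (q ^ i * x) =
      qPoch (q ^ (2 * mu)) (q ^ 2) i / qPoch (q ^ 2) (q ^ 2) i * (q ^ (2 * v + 2)) ^ i *
        phiOne (q ^ 2) (q ^ (2 * v + 2)) ((q ^ 2) ^ i * (q ^ 2 * x ^ 2)) := fun i => by
    rw [jHE_eq_phiOne, raiseCoeff]
    congr 2
    ring
  simp_rw [hterm]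
  rw [jHE_eq_phiOne, cqv, cqv, e]
  linear_combination (1 / (1 - q)) / qPochInf (q ^ 2) (q ^ 2) * h

lemma zpow_mul_rpow_zpow (hq0 : 0 < q) (v : ℝ) (n : ℤ) :
    q ^ n * (q ^ n) ^ (2 * v + 1) = (q ^ (2 * v + 2)) ^ n := by
  rw [← Real.rpow_intCast, ← Real.rpow_intCast, ← Real.rpow_mul hq0.le, ← Real.rpow_mul hq0.le,
    ← Real.rpow_add hq0]
  ring_nf

lemma Dker_zpow (hq0 : 0 < q) (v : ℝ) (a b d : ℤ) :
    Dker q v (q ^ a) (q ^ b) (q ^ d) = cqv q v ^ 2 * ((1 - q) * ∑' n : ℤ,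
      (q ^ (2 * v + 2)) ^ n * jHE q v (q ^ (a + n)) *
        (jHE q v (q ^ (b + n)) * jHE q v (q ^ (d + n)))) := by
  rw [Dker, jackson]
  congr 2
  refine tsum_congr fun n => ?_
  rw [← zpow_mul_rpow_zpow hq0, zpow_add₀ hq0.ne', zpow_add₀ hq0.ne', zpow_add₀ hq0.ne']
  ring

/-- Translating a unit mass at `z` produces the kernel `D_v`. -/
lemma Dker_nonneg (hv : q ∈ Qset v) {x y z : ℝ} (hx : x ∈ Rq q) (hy : y ∈ Rq q)
    (hz : z ∈ Rq q) : 0 ≤ Dker q v x y z := by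
  classical
  obtain ⟨⟨hq0, hq1⟩, hpos⟩ := hv
  obtain ⟨d, rfl⟩ := hz
  set f : ℝ → ℝ := fun t => if t = q ^ d then 1 else 0 with hf
  have hfd : f (q ^ d) = 1 := if_pos rfl
  have hfn : ∀ n : ℤ, n ≠ d → f (q ^ n) = 0 := fun n hn =>
    if_neg fun h => hn (zpow_right_injective₀ hq0 hq1.ne h)
  have hmem : memL1 q v f :=
    summable_of_ne_finset_zero (s := {d}) fun n hn => by
      rw [hfn n (by simpa using hn)]; simp
  have hfour : ∀ t, qFourier q v f t =
      cqv q v * ((1 - q) * (q ^ d * (q ^ d) ^ (2 * v + 1) * jHE q v (q ^ d * t))) := fun t => by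
    rw [qFourier, jackson, tsum_eq_single d (fun n hn => by rw [hfn n hn]; simp), hfd,
      mul_comm t]
    ring
  have hT := hpos x hx f hmem (fun t _ => by rw [hf]; dsimp only; split_ifs <;> norm_num) y hy
  have hTD : qTrans q v x f y =
      (1 - q) * (q ^ d * (q ^ d) ^ (2 * v + 1)) * Dker q v x y (q ^ d) := by
    rw [qTrans, Dker, jackson, jackson]
    simp_rw [hfour]
    rw [← tsum_mul_left, ← tsum_mul_left, ← tsum_mul_left, ← tsum_mul_left, ← tsum_mul_left]
    exact tsum_congr fun n => by ring
  rw [hTD] at hT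
  have h1 : 0 < (1 - q) * (q ^ d * (q ^ d) ^ (2 * v + 1)) := by
    have := Real.rpow_pos_of_pos (zpow_pos hq0 d) (2 * v + 1)
    have := sub_pos.2 hq1
    positivity
  exact nonneg_of_mul_nonneg_right hT h1

/-- Summability of the combined lattice and coefficient sum behind the mixed kernel. -/
lemma summable_mixed (hq0 : 0 < q) (hq1 : q < 1) (hv : -1 < v) (mu : ℝ) (a b d : ℤ) :
    Summable fun w : ℤ × (ℕ × ℕ) =>
      |(q ^ (2 * v + 2)) ^ w.1 * jHE q v (q ^ (a + w.1)) *
        (raiseCoeff q v mu w.2.1 * raiseCoeff q v mu w.2.2) *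
        (jHE q v (q ^ (w.2.1 + b + w.1)) * jHE q v (q ^ (w.2.2 + d + w.1)))| := by
  obtain ⟨K, hK, h⟩ := exists_abs_jHE_le_const hq0 hq1 hv
  have hw := summable_raiseCoeff hq0 hq1 hv mu
  have hww : Summable fun w : ℕ × ℕ => |raiseCoeff q v mu w.1 * raiseCoeff q v mu w.2| := by
    simpa using summable_prod_of_factors hw hw (h := fun _ _ => (1 : ℝ)) (C := 1) (by simp)
  have hC : ∀ (n : ℤ) (w : ℕ × ℕ),
      |jHE q v (q ^ (w.1 + b + n)) * jHE q v (q ^ (w.2 + d + n))| ≤ K * K := fun n w => by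
    rw [abs_mul]
    exact mul_le_mul (h _) (h _) (abs_nonneg _) hK
  exact summable_prod_of_factors
    (f := fun n : ℤ => (q ^ (2 * v + 2)) ^ n * jHE q v (q ^ (a + n)))
    (g := fun w : ℕ × ℕ => raiseCoeff q v mu w.1 * raiseCoeff q v mu w.2)
    (h := fun (n : ℤ) (w : ℕ × ℕ) => jHE q v (q ^ (w.1 + b + n)) * jHE q v (q ^ (w.2 + d + n)))
    (summable_zpow_mul_jHE hq0 hq1 hv a) hww hC

lemma summable_raiseCoeff_mul_jHE (hq0 : 0 < q) (hq1 : q < 1) (hv : -1 < v) (mu : ℝ) (b : ℤ) :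
    Summable fun i : ℕ => ‖raiseCoeff q v mu i * jHE q v (q ^ (i + b))‖ := by
  obtain ⟨K, hK, h⟩ := exists_abs_jHE_le_const hq0 hq1 hv
  refine Summable.of_nonneg_of_le (fun _ => norm_nonneg _) (fun i => ?_)
    ((summable_raiseCoeff hq0 hq1 hv mu).mul_right K)
  rw [norm_mul]
  exact mul_le_mul_of_nonneg_left (h _) (abs_nonneg _)

lemma raiseCoeff_mul_Dker (hq0 : 0 < q) (v mu : ℝ) (a b d : ℤ) (w : ℕ × ℕ) :
    qPoch (q ^ (2 * mu : ℝ)) (q ^ 2) w.1 / qPoch (q ^ 2) (q ^ 2) w.1 *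
      (qPoch (q ^ (2 * mu : ℝ)) (q ^ 2) w.2 / qPoch (q ^ 2) (q ^ 2) w.2) *
      q ^ (2 * (1 + v) * ((w.1 : ℝ) + (w.2 : ℝ))) *
      Dker q v (q ^ a) (q ^ w.1 * q ^ b) (q ^ w.2 * q ^ d) =
    cqv q v ^ 2 * (1 - q) * ∑' n : ℤ, (q ^ (2 * v + 2)) ^ n * jHE q v (q ^ (a + n)) *
        (raiseCoeff q v mu w.1 * raiseCoeff q v mu w.2) *
        (jHE q v (q ^ (w.1 + b + n)) * jHE q v (q ^ (w.2 + d + n))) := by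
  have hpow : q ^ (2 * (1 + v) * ((w.1 : ℝ) + (w.2 : ℝ))) =
      (q ^ (2 * v + 2)) ^ w.1 * (q ^ (2 * v + 2)) ^ w.2 := by
    rw [← Real.rpow_natCast, ← Real.rpow_natCast, ← Real.rpow_mul hq0.le, ← Real.rpow_mul hq0.le,
      ← Real.rpow_add hq0]
    ring_nf
  have h1 : q ^ w.1 * q ^ b = q ^ (w.1 + b) := by rw [zpow_add₀ hq0.ne', zpow_natCast]
  have h2 : q ^ w.2 * q ^ d = q ^ (w.2 + d) := by rw [zpow_add₀ hq0.ne', zpow_natCast]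
  rw [h1, h2, Dker_zpow hq0, hpow, ← tsum_mul_left, ← tsum_mul_left, ← tsum_mul_left,
    ← tsum_mul_left]
  exact tsum_congr fun n => by simp only [raiseCoeff]; ring

lemma Tmix_zpow (hq0 : 0 < q) (hq1 : q < 1) (hv : -1 < v) {mu : ℝ} (hmu : 0 < mu) (a b d : ℤ) :
    Tmix q v (v + mu) v (q ^ a) (q ^ b) (q ^ d) =
      cqv q v ^ 2 * (1 - q) * ∑' n : ℤ, ∑' w : ℕ × ℕ,
        (q ^ (2 * v + 2)) ^ n * jHE q v (q ^ (a + n)) *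
        (raiseCoeff q v mu w.1 * raiseCoeff q v mu w.2) *
        (jHE q v (q ^ (w.1 + b + n)) * jHE q v (q ^ (w.2 + d + n))) := by
  rw [Tmix, jackson, mul_assoc (cqv q v ^ 2), ← tsum_mul_left, ← tsum_mul_left, ← tsum_mul_left,
    ← tsum_mul_left]
  refine tsum_congr fun n => ?_
  have hmul : ∀ k : ℤ, q ^ n * q ^ k = q ^ (k + n) := fun k => by
    rw [zpow_add₀ hq0.ne', mul_comm]
  have hraise : ∀ k : ℤ, cqv q (v + mu) * jHE q (v + mu) (q ^ (k + n)) =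
      cqv q v * ∑' i : ℕ, raiseCoeff q v mu i * jHE q v (q ^ (i + (k + n))) := fun k => by
    rw [cqv_mul_jHE_add hq0 hq1 hv hmu]
    congr 1
    refine tsum_congr fun i => ?_
    rw [zpow_add₀ hq0.ne' (i : ℤ), zpow_natCast]
  have hprod := tsum_mul_tsum_of_summable_norm
    (summable_raiseCoeff_mul_jHE hq0 hq1 hv mu (b + n))
    (summable_raiseCoeff_mul_jHE hq0 hq1 hv mu (d + n))
  have hw : ∑' w : ℕ × ℕ, (q ^ (2 * v + 2)) ^ n * jHE q v (q ^ (a + n)) *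
        (raiseCoeff q v mu w.1 * raiseCoeff q v mu w.2) *
        (jHE q v (q ^ (w.1 + b + n)) * jHE q v (q ^ (w.2 + d + n))) =
      (q ^ (2 * v + 2)) ^ n * jHE q v (q ^ (a + n)) *
        ((∑' i : ℕ, raiseCoeff q v mu i * jHE q v (q ^ (i + (b + n)))) *
          ∑' j : ℕ, raiseCoeff q v mu j * jHE q v (q ^ (j + (d + n)))) := by
    rw [hprod, ← tsum_mul_left]
    refine tsum_congr fun w => ?_
    rw [add_assoc, add_assoc]
    ring
  rw [hw, hmul, hmul, hmul, ← zpow_mul_rpow_zpow hq0]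
  calc _ = (1 - q) * (q ^ n * (q ^ n) ^ (2 * v + 1) * jHE q v (q ^ (a + n))) *
        ((cqv q (v + mu) * jHE q (v + mu) (q ^ (b + n))) *
          (cqv q (v + mu) * jHE q (v + mu) (q ^ (d + n)))) := by ring
    _ = _ := by rw [hraise, hraise]; ring

end HahnExton

/-- expansion of the mixed kernel `T_{v,v+μ,v}` in terms of `D_v`,
and its positivity for `q ∈ Q_v`. -/
theorem stmt19 (q v mu : ℝ) (hq0 : 0 < q) (hq1 : q < 1) (hv : -1 < v)
    (hmu0 : 0 < mu) (hmu1 : mu < 1) :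
    ∀ x ∈ Rq q, ∀ y ∈ Rq q, ∀ z ∈ Rq q,
      Summable (fun p : ℕ × ℕ =>
        |qPoch (q ^ (2 * mu : ℝ)) (q ^ 2) p.1 / qPoch (q ^ 2) (q ^ 2) p.1 *
          (qPoch (q ^ (2 * mu : ℝ)) (q ^ 2) p.2 / qPoch (q ^ 2) (q ^ 2) p.2) *
          q ^ (2 * (1 + v) * ((p.1 : ℝ) + (p.2 : ℝ))) *
          Dker q v x (q ^ (p.1 : ℕ) * y) (q ^ (p.2 : ℕ) * z)|) ∧
      Tmix q v (v + mu) v x y z =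
        (∑' p : ℕ × ℕ,
          qPoch (q ^ (2 * mu : ℝ)) (q ^ 2) p.1 / qPoch (q ^ 2) (q ^ 2) p.1 *
            (qPoch (q ^ (2 * mu : ℝ)) (q ^ 2) p.2 / qPoch (q ^ 2) (q ^ 2) p.2) *
            q ^ (2 * (1 + v) * ((p.1 : ℝ) + (p.2 : ℝ))) *
            Dker q v x (q ^ (p.1 : ℕ) * y) (q ^ (p.2 : ℕ) * z)) ∧
      (q ∈ Qset v → 0 ≤ Tmix q v (v + mu) v x y z) := by
  rintro x ⟨a, rfl⟩ y ⟨b, rfl⟩ z ⟨d, rfl⟩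
  have hs := (summable_mixed hq0 hq1 hv mu a b d).of_abs
  have hTmix : Tmix q v (v + mu) v (q ^ a) (q ^ b) (q ^ d) =
      ∑' w : ℕ × ℕ, qPoch (q ^ (2 * mu : ℝ)) (q ^ 2) w.1 / qPoch (q ^ 2) (q ^ 2) w.1 *
        (qPoch (q ^ (2 * mu : ℝ)) (q ^ 2) w.2 / qPoch (q ^ 2) (q ^ 2) w.2) *
        q ^ (2 * (1 + v) * ((w.1 : ℝ) + (w.2 : ℝ))) *
        Dker q v (q ^ a) (q ^ w.1 * q ^ b) (q ^ w.2 * q ^ d) := by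
    simp_rw [raiseCoeff_mul_Dker hq0]
    rw [Tmix_zpow hq0 hq1 hv hmu0, tsum_mul_left]
    congr 1
    exact (Summable.tsum_comm hs).symm
  refine ⟨?_, hTmix, fun hQ => ?_⟩
  · simp_rw [raiseCoeff_mul_Dker hq0]
    exact (hs.prod_symm.prod.mul_left _).abs
  · rw [hTmix]
    refine tsum_nonneg fun w => mul_nonneg (mul_nonneg (mul_nonneg ?_ ?_) (by positivity))
      (Dker_nonneg hQ ⟨a, rfl⟩ ⟨w.1 + b, ?_⟩ ⟨w.2 + d, ?_⟩)
    · exact qBinomialCoeff_nonneg hq0 hq1 hmu0 _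
    · exact qBinomialCoeff_nonneg hq0 hq1 hmu0 _
    · rw [zpow_add₀ hq0.ne', zpow_natCast]
    · rw [zpow_add₀ hq0.ne', zpow_natCast]
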